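/- arXiv:1606.02044 — 3 statements merged into one kernel-verified Lean document; each statement's English description precedes it below -/
import Mathlib

section
/- For every complex number s ≠ 1, the series Σ_{n=0}^∞ C_{n+1} Σ_{k=0}^n (−1)^k C(n,k) (k+2)^{−s} converges and ζ(s) = 1/(s−1) + 1 − Σ_{n=0}^∞ C_{n+1} Σ_{k=0}^n (−1)^k C(n,k) (k+2)^{−s}, where C_n are the normalized Cauchy numbers of the second kind. -/
open Filter Finset intervalIntegral

/-- The normalized Cauchy numbers of the second kind
`C_n = ∫₀¹ x(x+1)(x+2)⋯(x+n−1)/n! dx`. -/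
noncomputable def cauchyC (n : ℕ) : ℝ :=
  ∫ x in (0:ℝ)..1, (∏ i ∈ Finset.range n, (x + (i : ℝ))) / (n.factorial : ℝ)

/-- The function `exp (-a t) (1 - exp (-t)) ^ n`, whose Mellin transform is
`Gamma s * altSum n a s`. -/
noncomputable def expKernel (n a : ℕ) (t : ℝ) : ℝ :=
  Real.exp (-a * t) * (1 - Real.exp (-t)) ^ n

/-- The alternating sum `∑ (-1)^k C(n,k) (k+a)^(-s)`. -/
noncomputable def altSum (n a : ℕ) (s : ℂ) : ℂ :=
  ∑ k ∈ Finset.range (n + 1), (-1) ^ k * (n.choose k : ℂ) * ((k : ℂ) + a) ^ (-s)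

lemma ascPochhammer_eval_eq_prod (x : ℝ) (n : ℕ) :
    (ascPochhammer ℝ n).eval x = ∏ i ∈ Finset.range n, (x + (i : ℝ)) := by
  induction n with
  | zero => simp
  | succ n ih => rw [ascPochhammer_succ_eval, ih, Finset.prod_range_succ]

lemma ring_choose_add_sub_one (x : ℝ) (n : ℕ) :
    Ring.choose (x + n - 1) n = (∏ i ∈ Finset.range n, (x + (i : ℝ))) / (n.factorial : ℝ) := by
  have h := Ring.factorial_nsmul_multichoose_eq_ascPochhammer x n
  rw [Polynomial.ascPochhammer_smeval_eq_eval, ascPochhammer_eval_eq_prod, nsmul_eq_mul] at h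
  rw [eq_div_iff (by positivity), ← h, Ring.choose, mul_comm]
  congr 2
  ring

lemma hasSum_rising_factorial_mul_pow (x : ℝ) {z : ℝ} (h0 : 0 ≤ z) (h1 : z < 1) :
    HasSum (fun n : ℕ => (∏ i ∈ Finset.range n, (x + (i : ℝ))) / (n.factorial : ℝ) * z ^ n)
      (1 / (1 - z) ^ x) := by
  have h := (Real.one_div_one_sub_rpow_hasFPowerSeriesOnBall_zero x).hasSum (y := z)
    (by rw [← ENNReal.ofReal_one, Metric.eball_ofReal]; simpa [abs_of_nonneg h0] using h1)
  simpa [ring_choose_add_sub_one, mul_comm] using h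

lemma rising_factorial_div_le_one {x : ℝ} (h0 : 0 ≤ x) (h1 : x ≤ 1) (n : ℕ) :
    (∏ i ∈ Finset.range n, (x + (i : ℝ))) / (n.factorial : ℝ) ≤ 1 := by
  rw [div_le_one (by positivity), ← Finset.prod_range_add_one_eq_factorial]
  push_cast
  exact Finset.prod_le_prod (fun i _ => by positivity) (fun i _ => by linarith)

lemma cauchyC_nonneg (n : ℕ) : 0 ≤ cauchyC n :=
  intervalIntegral.integral_nonneg zero_le_one fun x hx => by
    have := hx.1
    positivity

lemma cauchyC_le_one (n : ℕ) : cauchyC n ≤ 1 := by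
  have h : cauchyC n ≤ ∫ _ in (0:ℝ)..1, (1:ℝ) :=
    intervalIntegral.integral_mono_on zero_le_one
      (Continuous.intervalIntegrable (by fun_prop) _ _) (by simp)
      fun x hx => rising_factorial_div_le_one hx.1 hx.2 n
  simpa using h

lemma cauchyC_zero : cauchyC 0 = 1 := by simp [cauchyC]

/-- The generating function of the numbers `cauchyC n`, evaluated at `1 - exp (-t)`. -/
lemma hasSum_cauchyC_mul_pow {t : ℝ} (ht : 0 < t) :
    HasSum (fun n : ℕ => cauchyC n * (1 - Real.exp (-t)) ^ n) ((Real.exp t - 1) / t) := by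
  set z := 1 - Real.exp (-t) with hz
  have hz0 : 0 ≤ z := by simp [hz, ht.le]
  have hz1 : z < 1 := by simp [hz, Real.exp_pos]
  have h := intervalIntegral.hasSum_integral_of_dominated_convergence (a := 0) (b := 1)
    (μ := MeasureTheory.volume)
    (F := fun (n : ℕ) (x : ℝ) =>
      (∏ i ∈ Finset.range n, (x + (i : ℝ))) / (n.factorial : ℝ) * z ^ n)
    (f := fun x => 1 / (1 - z) ^ x) (fun n _ => z ^ n)
    (fun n => (Continuous.aestronglyMeasurable (by fun_prop)))
    (fun n => .of_forall fun x hx => by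
      rw [Set.uIoc_of_le zero_le_one] at hx
      have := hx.1.le
      rw [Real.norm_of_nonneg (by positivity)]
      exact mul_le_of_le_one_left (by positivity) (rising_factorial_div_le_one hx.1.le hx.2 n))
    (.of_forall fun x _ => summable_geometric_of_lt_one hz0 hz1)
    (by simp)
    (.of_forall fun x _ => hasSum_rising_factorial_mul_pow x hz0 hz1)
  have hval : ∫ x in (0:ℝ)..1, 1 / (1 - z) ^ x = (Real.exp t - 1) / t := by
    have : ∀ x : ℝ, 1 / (1 - z) ^ x = Real.exp (t * x) := fun x => by
      rw [hz, sub_sub_cancel, ← Real.exp_mul, one_div, ← Real.exp_neg]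
      ring_nf
    simp_rw [this]
    rw [intervalIntegral.integral_comp_mul_left _ ht.ne']
    simp [integral_exp, div_eq_inv_mul]
  rw [hval] at h
  simpa [cauchyC, intervalIntegral.integral_mul_const] using h

lemma hasSum_cauchyC_succ_mul {t : ℝ} (ht : 0 < t) :
    HasSum (fun n : ℕ => cauchyC (n + 1) * expKernel n 2 t)
      (Real.exp (-t) / t - Real.exp (-2 * t) / (1 - Real.exp (-t))) := by
  have hz : 1 - Real.exp (-t) ≠ 0 := by
    have : Real.exp (-t) < 1 := by simpa using ht
    linarith
  have h := (hasSum_nat_add_iff' 1).2 (hasSum_cauchyC_mul_pow ht)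
  have h2 := h.mul_left (Real.exp (-2 * t) / (1 - Real.exp (-t)))
  have he : Real.exp (-2 * t) = Real.exp (-t) ^ 2 := by rw [← Real.exp_nat_mul]; ring_nf
  have he' : Real.exp t = (Real.exp (-t))⁻¹ := by rw [← Real.exp_neg, neg_neg]
  have h0 := (Real.exp_pos (-t)).ne'
  convert! h2 using 1
  · funext n
    rw [expKernel, Nat.cast_ofNat, pow_succ]
    field_simp
  · simp only [Finset.sum_range_one, cauchyC_zero, he, he']
    field_simp

lemma expKernel_eq_sum (n a : ℕ) (t : ℝ) :
    expKernel n a t =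
      ∑ k ∈ Finset.range (n + 1), (-1) ^ k * (n.choose k : ℝ) * Real.exp (-(k + a) * t) := by
  rw [expKernel, sub_eq_neg_add, add_pow, Finset.mul_sum]
  refine Finset.sum_congr rfl fun k _ => ?_
  rw [neg_pow, ← Real.exp_nat_mul, one_pow, neg_add, add_mul, Real.exp_add]
  ring_nf

lemma expKernel_nonneg (n a : ℕ) {t : ℝ} (ht : 0 < t) : 0 ≤ expKernel n a t := by
  have : 0 ≤ 1 - Real.exp (-t) := by simpa using ht.le
  unfold expKernel
  positivity

lemma mellin_expKernel (n : ℕ) {a : ℕ} (ha : 0 < a) {s : ℂ} (hs : 0 < s.re) :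
    mellin (fun t => (expKernel n a t : ℂ)) s = Complex.Gamma s * altSum n a s := by
  have hzero : ∀ k ∉ Finset.range (n + 1), n.choose k = 0 := fun k hk =>
    Nat.choose_eq_zero_of_lt (by simpa using hk)
  have h := hasSum_mellin (a := fun k : ℕ => (-1) ^ k * (n.choose k : ℂ))
    (p := fun k => (k : ℝ) + a) (F := fun t => (expKernel n a t : ℂ)) (s := s)
    (fun k => Or.inr (by positivity)) hs
    (fun t _ => by
      rw [expKernel_eq_sum]
      push_cast
      exact hasSum_sum_of_ne_finset_zero fun k hk => by simp [hzero k hk])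
    (summable_of_ne_finset_zero (s := Finset.range (n + 1)) fun k hk => by simp [hzero k hk])
  refine h.unique ?_
  have h' := hasSum_sum_of_ne_finset_zero (L := SummationFilter.unconditional ℕ)
    (s := Finset.range (n + 1))
    (f := fun k : ℕ => Complex.Gamma s * ((-1) ^ k * (n.choose k : ℂ)) /
      (((k : ℝ) + a : ℝ) : ℂ) ^ s) fun k hk => by simp [hzero k hk]
  convert! h' using 1
  rw [altSum, Finset.mul_sum]
  refine Finset.sum_congr rfl fun k _ => ?_
  push_cast
  rw [Complex.cpow_neg]
  ring

lemma altSum_zero (a : ℕ) (s : ℂ) : altSum 0 a s = (a : ℂ) ^ (-s) := by simp [altSum]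

lemma cpow_neg_eq_mul {z : ℂ} (hz : z ≠ 0) (s : ℂ) : z ^ (-s) = z * z ^ (-(s + 1)) := by
  rw [neg_add, Complex.cpow_add _ _ hz, Complex.cpow_neg_one]
  field_simp

lemma altSum_succ {a : ℕ} (ha : 0 < a) (n : ℕ) (s : ℂ) :
    altSum (n + 1) a s =
      a * altSum (n + 1) a (s + 1) - (n + 1) * altSum n (a + 1) (s + 1) := by
  have h : ∀ k : ℕ, (k : ℂ) + a ≠ 0 := fun k => by exact_mod_cast (by omega : k + a ≠ 0)
  have h1 : altSum (n + 1) a s = a * altSum (n + 1) a (s + 1) +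
      ∑ k ∈ Finset.range (n + 1 + 1),
        k * ((-1) ^ k * ((n + 1).choose k : ℂ) * ((k : ℂ) + a) ^ (-(s + 1))) := by
    simp only [altSum, Finset.mul_sum, ← Finset.sum_add_distrib]
    refine Finset.sum_congr rfl fun k _ => ?_
    rw [cpow_neg_eq_mul (h k) s]
    ring
  rw [h1, sub_eq_add_neg, Finset.sum_range_succ']
  simp only [altSum, Finset.mul_sum, ← Finset.sum_neg_distrib]
  simp only [Nat.cast_zero, zero_mul, add_zero]
  congr 1
  refine Finset.sum_congr rfl fun k _ => ?_
  have hc : ((n : ℂ) + 1) * n.choose k = (n + 1).choose (k + 1) * (k + 1) := by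
    exact_mod_cast Nat.add_one_mul_choose_eq n k
  rw [mul_assoc ((-1 : ℂ) ^ k), ← neg_mul, ← mul_assoc, ← mul_assoc]
  push_cast
  rw [show (k : ℂ) + 1 + a = k + (a + 1) by ring]
  linear_combination (-(-1) ^ k * ((k : ℂ) + (a + 1)) ^ (-(s + 1))) * (-hc)

/-- The constant in the decay estimate `expKernel_le`. -/
noncomputable def decayConst (a : ℕ) : ℝ := (a - 1 / 2 : ℝ) ^ (a - 1 / 2 : ℝ) * Real.exp 1

lemma expKernel_le (n : ℕ) {a : ℕ} (ha : 0 < a) (t : ℝ) (ht : 0 < t) :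
    expKernel n a t ≤ decayConst a *
      ((n : ℝ) + 1) ^ (-(a - 1 / 2 : ℝ)) * Real.exp (-(1 / 2) * t) := by
  have ha' : (1 : ℝ) ≤ a := by exact_mod_cast ha
  unfold decayConst
  set b : ℝ := a - 1 / 2 with hb
  have hb0 : 0 < b := by linarith
  set u := Real.exp (-t) with hu
  have hu0 : 0 < u := Real.exp_pos _
  have hu1 : u ≤ 1 := by simp [hu, ht.le]
  have hx : 0 < ((n : ℝ) + 1) * u := by positivity
  have h1 : (((n : ℝ) + 1) * u) ^ b ≤ b ^ b * Real.exp (((n : ℝ) + 1) * u) := by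
    have h : ((n : ℝ) + 1) * u / b ≤ Real.exp (((n : ℝ) + 1) * u / b) := by
      linarith [Real.add_one_le_exp (((n : ℝ) + 1) * u / b)]
    have h' := Real.rpow_le_rpow (by positivity) h hb0.le
    rw [← Real.exp_mul, div_mul_cancel₀ _ hb0.ne', Real.div_rpow hx.le hb0.le,
      div_le_iff₀ (by positivity)] at h'
    linarith
  have h2 : (1 - u) ^ n ≤ Real.exp (-(n * u)) := by
    have := pow_le_pow_left₀ (by linarith) (Real.one_sub_le_exp_neg u) n
    rwa [← Real.exp_nat_mul, mul_neg] at this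
  have h3 : u ^ b * (1 - u) ^ n ≤ b ^ b * Real.exp 1 * ((n : ℝ) + 1) ^ (-b) := by
    rw [Real.rpow_neg (by positivity), ← div_eq_mul_inv, le_div_iff₀ (by positivity)]
    calc u ^ b * (1 - u) ^ n * ((n : ℝ) + 1) ^ b
        = (((n : ℝ) + 1) * u) ^ b * (1 - u) ^ n := by
          rw [Real.mul_rpow (by positivity) hu0.le]; ring
      _ ≤ (b ^ b * Real.exp (((n : ℝ) + 1) * u)) * Real.exp (-(n * u)) := by
          have : 0 ≤ 1 - u := by linarith
          gcongr
      _ = b ^ b * Real.exp u := by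
          rw [mul_assoc, ← Real.exp_add]; ring_nf
      _ ≤ _ := by gcongr
  have h4 : Real.exp (-a * t) = u ^ b * Real.exp (-(1 / 2) * t) := by
    rw [hu, ← Real.exp_mul, ← Real.exp_add, hb]; ring_nf
  calc expKernel n a t = (u ^ b * (1 - u) ^ n) * Real.exp (-(1 / 2) * t) := by
        rw [expKernel, h4]; ring
    _ ≤ _ := by gcongr

lemma integrableOn_rpow_mul_exp_half {σ : ℝ} (hσ : 0 < σ) :
    MeasureTheory.IntegrableOn (fun t : ℝ => t ^ (σ - 1) * Real.exp (-(1 / 2) * t))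
      (Set.Ioi 0) := by
  simpa using integrableOn_rpow_mul_exp_neg_mul_rpow (s := σ - 1) (p := 1) (b := 1 / 2)
    (by linarith) one_pos (by norm_num)

lemma norm_cpow_smul_expKernel_le (n : ℕ) {a : ℕ} (ha : 0 < a) (s : ℂ) {t : ℝ} (ht : 0 < t) :
    ‖(t : ℂ) ^ (s - 1) • (expKernel n a t : ℂ)‖ ≤ decayConst a *
      ((n : ℝ) + 1) ^ (-(a - 1 / 2 : ℝ)) * (t ^ (s.re - 1) * Real.exp (-(1 / 2) * t)) := by
  rw [norm_smul, Complex.norm_cpow_eq_rpow_re_of_pos ht, Complex.norm_real,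
    Real.norm_of_nonneg (expKernel_nonneg n a ht), Complex.sub_re, Complex.one_re]
  calc _ ≤ t ^ (s.re - 1) * (decayConst a *
      ((n : ℝ) + 1) ^ (-(a - 1 / 2 : ℝ)) * Real.exp (-(1 / 2) * t)) := by
        gcongr
        exact expKernel_le n ha t ht
    _ = _ := by ring

lemma mellinConvergent_expKernel (n : ℕ) {a : ℕ} (ha : 0 < a) {s : ℂ} (hs : 0 < s.re) :
    MellinConvergent (fun t => (expKernel n a t : ℂ)) s := by
  refine ((integrableOn_rpow_mul_exp_half hs).const_mul _).mono' ?_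
    (MeasureTheory.ae_restrict_of_forall_mem measurableSet_Ioi
      fun t ht => norm_cpow_smul_expKernel_le n ha s ht)
  unfold expKernel
  exact Measurable.aestronglyMeasurable (by fun_prop)

lemma integral_norm_expKernel_le (n : ℕ) {a : ℕ} (ha : 0 < a) {s : ℂ} (hs : 0 < s.re) :
    ∫ t in Set.Ioi (0:ℝ), ‖(t : ℂ) ^ (s - 1) • (expKernel n a t : ℂ)‖ ≤
      decayConst a * ((n : ℝ) + 1) ^ (-(a - 1 / 2 : ℝ)) * (2 ^ s.re * Real.Gamma s.re) := by
  calc _ ≤ ∫ t in Set.Ioi (0:ℝ), decayConst a *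
      ((n : ℝ) + 1) ^ (-(a - 1 / 2 : ℝ)) * (t ^ (s.re - 1) * Real.exp (-(1 / 2) * t)) :=
        MeasureTheory.setIntegral_mono_on (mellinConvergent_expKernel n ha hs).norm
          ((integrableOn_rpow_mul_exp_half hs).const_mul _) measurableSet_Ioi
          fun t ht => norm_cpow_smul_expKernel_le n ha s ht
    _ = _ := by
      have := Real.integral_rpow_mul_exp_neg_mul_Ioi hs (r := 1 / 2) (by norm_num)
      rw [MeasureTheory.integral_const_mul]
      simp only [neg_mul]
      rw [this]
      norm_num

lemma differentiable_altSum (n : ℕ) {a : ℕ} (ha : 0 < a) : Differentiable ℂ (altSum n a) := by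
  refine Differentiable.fun_sum fun k _ => Differentiable.const_mul ?_ _
  refine differentiable_id.neg.const_cpow (Or.inl ?_)
  exact_mod_cast (by omega : k + a ≠ 0)

lemma norm_altSum_le (n : ℕ) {a : ℕ} (ha : 0 < a) {s : ℂ} (hs : 0 < s.re) :
    ‖altSum n a s‖ ≤ decayConst a * (2 ^ s.re * Real.Gamma s.re / ‖Complex.Gamma s‖) *
      ((n : ℝ) + 1) ^ (-(a - 1 / 2 : ℝ)) := by
  have hG : 0 < ‖Complex.Gamma s‖ := norm_pos_iff.2 (Complex.Gamma_ne_zero_of_re_pos hs)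
  have h : ‖Complex.Gamma s * altSum n a s‖ ≤ decayConst a *
      ((n : ℝ) + 1) ^ (-(a - 1 / 2 : ℝ)) * (2 ^ s.re * Real.Gamma s.re) := by
    rw [← mellin_expKernel n ha hs]
    exact (MeasureTheory.norm_integral_le_integral_norm _).trans
      (integral_norm_expKernel_le n ha hs)
  rw [norm_mul] at h
  calc ‖altSum n a s‖ = ‖Complex.Gamma s‖ * ‖altSum n a s‖ / ‖Complex.Gamma s‖ := by field_simp
    _ ≤ _ := div_le_div_of_nonneg_right h hG.le
    _ = _ := by ring

/-- The sums `altSum n a s` are `O((n+1)^(1/2-a))`, locally uniformly in `s`. -/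
lemma exists_eventually_norm_altSum_le (m : ℕ) :
    ∀ s₀ : ℂ, -(m : ℝ) < s₀.re → ∀ a : ℕ, 0 < a → ∃ C : ℝ, 0 ≤ C ∧
      ∀ᶠ s in nhds s₀, ∀ n, ‖altSum n a s‖ ≤ C * ((n : ℝ) + 1) ^ (-(a - 1 / 2 : ℝ)) := by
  induction m with
  | zero =>
    intro s₀ hs₀ a ha
    have hs₀ : 0 < s₀.re := by simpa using hs₀
    have ha' : (1 : ℝ) ≤ a := by exact_mod_cast ha
    have hK : 0 ≤ decayConst a := by
      have : (0 : ℝ) ≤ a - 1 / 2 := by linarith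
      unfold decayConst
      positivity
    set g : ℂ → ℝ := fun s => 2 ^ s.re * Real.Gamma s.re / ‖Complex.Gamma s‖ with hg
    have hre : ∀ (s : ℂ), 0 < s.re → ∀ k : ℕ, s ≠ -k := fun s hs k h => by
      rw [h] at hs
      simp at hs
      linarith [(Nat.cast_nonneg k : (0 : ℝ) ≤ k)]
    have hgc : ContinuousAt g s₀ := by
      have hGr : ContinuousAt (fun s : ℂ => Real.Gamma s.re) s₀ :=
        ContinuousAt.comp (f := Complex.re) (g := Real.Gamma)
          (Real.differentiableAt_Gamma fun k h => by
            linarith [(Nat.cast_nonneg k : (0 : ℝ) ≤ k)]).continuousAt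
          Complex.continuous_re.continuousAt
      refine ContinuousAt.div (ContinuousAt.mul ?_ hGr)
        (Complex.differentiableAt_Gamma s₀ (hre s₀ hs₀)).continuousAt.norm
        (norm_ne_zero_iff.2 (Complex.Gamma_ne_zero_of_re_pos hs₀))
      exact (Real.continuous_const_rpow two_ne_zero).continuousAt.comp
        Complex.continuous_re.continuousAt
    have hg0 : 0 ≤ g s₀ := by
      have := Real.Gamma_pos_of_pos hs₀
      positivity
    refine ⟨decayConst a * (g s₀ + 1), by positivity, ?_⟩
    filter_upwards [hgc.eventually (gt_mem_nhds (lt_add_one (g s₀))),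
      Complex.continuous_re.continuousAt.eventually (lt_mem_nhds hs₀)] with s hs hs' n
    refine (norm_altSum_le n ha hs').trans ?_
    gcongr
  | succ m ih =>
    intro s₀ hs₀ a ha
    have ha' : (1 : ℝ) ≤ a := by exact_mod_cast ha
    have hs₁ : -(m : ℝ) < (s₀ + 1).re := by
      push_cast at hs₀
      rw [Complex.add_re, Complex.one_re]
      linarith
    obtain ⟨C₁, hC₁, h₁⟩ := ih (s₀ + 1) hs₁ a ha
    obtain ⟨C₂, hC₂, h₂⟩ := ih (s₀ + 1) hs₁ (a + 1) a.succ_pos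
    have hadd : Tendsto (fun s : ℂ => s + 1) (nhds s₀) (nhds (s₀ + 1)) :=
      (continuous_id.add continuous_const).continuousAt
    refine ⟨a * C₁ + C₂ * 2 ^ (a - 1 / 2 : ℝ), by positivity, ?_⟩
    filter_upwards [hadd.eventually h₁, hadd.eventually h₂] with s h₁ h₂ n
    have hfirst : ‖(a : ℂ) * altSum n a (s + 1)‖ ≤
        a * C₁ * ((n : ℝ) + 1) ^ (-(a - 1 / 2 : ℝ)) := by
      rw [norm_mul, Complex.norm_natCast, mul_assoc]
      gcongr
      exact h₁ n
    rw [add_mul]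
    cases n with
    | zero =>
      rw [altSum_zero, cpow_neg_eq_mul (by exact_mod_cast ha.ne'), ← altSum_zero]
      exact hfirst.trans (le_add_of_nonneg_right (by positivity))
    | succ n =>
      rw [altSum_succ ha]
      refine (norm_sub_le _ _).trans (add_le_add hfirst ?_)
      have hn : (0 : ℝ) < (n : ℝ) + 1 := by positivity
      have hcast : ‖((n : ℂ) + 1)‖ = (n : ℝ) + 1 := by
        rw [← Nat.cast_add_one, Complex.norm_natCast, Nat.cast_add_one]
      rw [norm_mul, hcast]
      calc ((n : ℝ) + 1) * ‖altSum n (a + 1) (s + 1)‖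
          ≤ ((n : ℝ) + 1) * (C₂ * ((n : ℝ) + 1) ^ (-((a + 1 : ℕ) - 1 / 2 : ℝ))) := by
            gcongr
            exact h₂ n
        _ = C₂ * ((n : ℝ) + 1) ^ (-(a - 1 / 2 : ℝ)) := by
            rw [show (-(a - 1 / 2 : ℝ)) = 1 + -((a + 1 : ℕ) - 1 / 2 : ℝ) by push_cast; ring,
              Real.rpow_add hn, Real.rpow_one]
            ring
        _ = C₂ * 2 ^ (a - 1 / 2 : ℝ) * (2 * ((n : ℝ) + 1)) ^ (-(a - 1 / 2 : ℝ)) := by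
            rw [Real.mul_rpow two_pos.le hn.le, Real.rpow_neg two_pos.le]
            field_simp
        _ ≤ C₂ * 2 ^ (a - 1 / 2 : ℝ) * (((n + 1 : ℕ) : ℝ) + 1) ^ (-(a - 1 / 2 : ℝ)) := by
            refine mul_le_mul_of_nonneg_left ?_ (by positivity)
            refine Real.rpow_le_rpow_of_nonpos (by positivity) ?_ (by linarith)
            push_cast
            linarith

lemma summable_nat_add_one_rpow : Summable fun n : ℕ => ((n : ℝ) + 1) ^ (-(3 / 2) : ℝ) := by
  have h := (summable_nat_add_iff 1).2
    (Real.summable_nat_rpow (p := -(3 / 2)).2 (by norm_num))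
  simpa using h

lemma norm_cauchyC_mul_le (n : ℕ) (z : ℂ) : ‖(cauchyC n : ℂ) * z‖ ≤ ‖z‖ := by
  rw [norm_mul, Complex.norm_real, Real.norm_of_nonneg (cauchyC_nonneg n)]
  exact mul_le_of_le_one_left (norm_nonneg _) (cauchyC_le_one n)

lemma exists_eventually_norm_cauchyC_mul_altSum_le (s₀ : ℂ) :
    ∃ C : ℝ, ∀ᶠ s in nhds s₀, ∀ n,
      ‖(cauchyC (n + 1) : ℂ) * altSum n 2 s‖ ≤ C * ((n : ℝ) + 1) ^ (-(3 / 2) : ℝ) := by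
  obtain ⟨m, hm⟩ := exists_nat_gt (-s₀.re)
  obtain ⟨C, -, h⟩ := exists_eventually_norm_altSum_le m s₀ (by linarith) 2 two_pos
  refine ⟨C, h.mono fun s hs n => (norm_cauchyC_mul_le _ _).trans ((hs n).trans_eq ?_)⟩
  norm_num

lemma summable_cauchyC_mul_altSum (s : ℂ) :
    Summable fun n : ℕ => (cauchyC (n + 1) : ℂ) * altSum n 2 s := by
  obtain ⟨C, h⟩ := exists_eventually_norm_cauchyC_mul_altSum_le s
  exact (summable_nat_add_one_rpow.mul_left C).of_norm_bounded h.self_of_nhds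

lemma differentiable_tsum_cauchyC_mul_altSum :
    Differentiable ℂ fun s => ∑' n : ℕ, (cauchyC (n + 1) : ℂ) * altSum n 2 s := by
  intro s₀
  obtain ⟨C, h⟩ := exists_eventually_norm_cauchyC_mul_altSum_le s₀
  obtain ⟨U, hU, hUo, hsU⟩ := eventually_nhds_iff.1 h
  refine (Complex.differentiableOn_tsum_of_summable_norm
    (summable_nat_add_one_rpow.mul_left C)
    (fun n => ((differentiable_altSum n two_pos).const_mul _).differentiableOn) hUo
    fun n s hs => hU s hs n).differentiableAt (hUo.mem_nhds hsU)

lemma hasSum_one_div_add_two_cpow {s : ℂ} (hs : 1 < s.re) :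
    HasSum (fun n : ℕ => 1 / ((n : ℂ) + 2) ^ s) (riemannZeta s - 1) := by
  have hsum : Summable fun n : ℕ => 1 / ((n : ℂ) + 1) ^ s := by
    simpa using (summable_nat_add_iff 1).2 (Complex.summable_one_div_nat_cpow.2 hs)
  have h := hsum.hasSum
  rw [← zeta_eq_tsum_one_div_nat_add_one_cpow hs] at h
  have h1 := (hasSum_nat_add_iff' 1).2 h
  simpa [add_assoc, one_add_one_eq_two] using h1

lemma mellin_exp_div_one_sub {s : ℂ} (hs : 1 < s.re) :
    mellin (fun t : ℝ => ((Real.exp (-2 * t) / (1 - Real.exp (-t)) : ℝ) : ℂ)) s =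
      Complex.Gamma s * (riemannZeta s - 1) := by
  have hp : Summable fun n : ℕ => 1 / ((n : ℝ) + 2) ^ s.re := by
    simpa using (summable_nat_add_iff 2).2 (Real.summable_one_div_nat_rpow.2 hs)
  have h := hasSum_mellin (a := fun _ : ℕ => (1 : ℂ)) (p := fun k => (k : ℝ) + 2)
    (F := fun t => ((Real.exp (-2 * t) / (1 - Real.exp (-t)) : ℝ) : ℂ)) (s := s)
    (fun k => Or.inr (by positivity)) (by linarith)
    (fun t ht => by
      have h0 : Real.exp (-t) < 1 := by simpa using ht
      have h := (hasSum_geometric_of_lt_one (Real.exp_pos (-t)).le h0).mul_left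
        (Real.exp (-2 * t))
      rw [← div_eq_mul_inv] at h
      convert! Complex.hasSum_ofReal.2 h using 2 with n
      rw [one_mul, ← Real.exp_nat_mul, ← Real.exp_add]
      ring_nf)
    (by simpa using hp)
  refine h.unique ?_
  simpa [div_eq_mul_inv] using (hasSum_one_div_add_two_cpow hs).mul_left (Complex.Gamma s)

lemma cpow_smul_exp_div (s : ℂ) {t : ℝ} (ht : 0 < t) :
    (t : ℂ) ^ (s - 1) • ((Real.exp (-t) / t : ℝ) : ℂ) =
      ((Real.exp (-t) : ℝ) : ℂ) * (t : ℂ) ^ (s - 1 - 1) := by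
  have ht' : (t : ℂ) ≠ 0 := by exact_mod_cast ht.ne'
  rw [Complex.cpow_sub (s - 1) 1 ht', Complex.cpow_one]
  push_cast
  rw [smul_eq_mul]
  ring

lemma mellinConvergent_exp_div {s : ℂ} (hs : 1 < s.re) :
    MellinConvergent (fun t : ℝ => ((Real.exp (-t) / t : ℝ) : ℂ)) s :=
  (Complex.GammaIntegral_convergent (s := s - 1) (by simpa using hs)).congr_fun
    (fun _ ht => (cpow_smul_exp_div s ht).symm) measurableSet_Ioi

lemma mellin_exp_div_id {s : ℂ} (hs : 1 < s.re) :
    mellin (fun t : ℝ => ((Real.exp (-t) / t : ℝ) : ℂ)) s = Complex.Gamma (s - 1) := by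
  rw [Complex.Gamma_eq_integral (by simpa using hs), Complex.GammaIntegral]
  exact MeasureTheory.setIntegral_congr_fun measurableSet_Ioi
    fun t ht => cpow_smul_exp_div s ht

lemma exp_div_one_sub_le {t : ℝ} (ht : 0 < t) :
    Real.exp (-2 * t) / (1 - Real.exp (-t)) ≤ Real.exp (-t) / t := by
  have h0 : 0 < 1 - Real.exp (-t) := by simpa using ht
  have h1 : t + 1 ≤ Real.exp t := Real.add_one_le_exp t
  have h2 : Real.exp (-2 * t) = Real.exp (-t) * Real.exp (-t) := by
    rw [← Real.exp_add]; ring_nf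
  have h3 : Real.exp (-t) * Real.exp t = 1 := by rw [← Real.exp_add]; simp
  rw [div_le_div_iff₀ h0 ht, h2, mul_assoc]
  gcongr
  nlinarith [Real.exp_pos (-t)]

lemma mellinConvergent_exp_div_one_sub {s : ℂ} (hs : 1 < s.re) :
    MellinConvergent
      (fun t : ℝ => ((Real.exp (-2 * t) / (1 - Real.exp (-t)) : ℝ) : ℂ)) s := by
  refine MeasureTheory.Integrable.mono (mellinConvergent_exp_div hs)
    (Measurable.aestronglyMeasurable (by fun_prop))
    (MeasureTheory.ae_restrict_of_forall_mem measurableSet_Ioi fun t (ht : 0 < t) => ?_)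
  have h0 : 0 < 1 - Real.exp (-t) := by simpa using ht
  rw [norm_smul, norm_smul, Complex.norm_real, Complex.norm_real,
    Real.norm_of_nonneg (by positivity), Real.norm_of_nonneg (by positivity)]
  exact mul_le_mul_of_nonneg_left (exp_div_one_sub_le ht) (norm_nonneg _)

/-- The Mellin transform of the generating function of the numbers `cauchyC n`. -/
lemma hasSum_Gamma_mul_cauchyC_mul_altSum {s : ℂ} (hs : 1 < s.re) :
    HasSum (fun n : ℕ => Complex.Gamma s * ((cauchyC (n + 1) : ℂ) * altSum n 2 s))
      (Complex.Gamma (s - 1) - Complex.Gamma s * (riemannZeta s - 1)) := by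
  have hs0 : 0 < s.re := by linarith
  have h := MeasureTheory.hasSum_integral_of_summable_integral_norm
    (μ := MeasureTheory.volume.restrict (Set.Ioi (0:ℝ)))
    (F := fun (n : ℕ) (t : ℝ) =>
      (cauchyC (n + 1) : ℂ) * ((t : ℂ) ^ (s - 1) • (expKernel n 2 t : ℂ)))
    (fun n => (mellinConvergent_expKernel n two_pos hs0).const_mul _) (by
      refine ((summable_nat_add_one_rpow.mul_left (decayConst 2)).mul_right
        (2 ^ s.re * Real.Gamma s.re)).of_nonneg_of_le
        (fun n => MeasureTheory.integral_nonneg fun t => norm_nonneg _) fun n => ?_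
      have h1 := integral_norm_expKernel_le n two_pos hs0
      refine le_trans ?_ (h1.trans_eq (by norm_num))
      exact MeasureTheory.integral_mono
        ((mellinConvergent_expKernel n two_pos hs0).const_mul _).norm
        (mellinConvergent_expKernel n two_pos hs0).norm
        fun t => norm_cauchyC_mul_le _ _)
  convert! h using 1
  · funext n
    rw [MeasureTheory.integral_const_mul, ← mellin, mellin_expKernel n two_pos hs0]
    ring
  · rw [← mellin_exp_div_id hs, ← mellin_exp_div_one_sub hs, mellin, mellin,
      ← MeasureTheory.integral_sub (mellinConvergent_exp_div hs)
        (mellinConvergent_exp_div_one_sub hs)]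
    refine MeasureTheory.setIntegral_congr_fun measurableSet_Ioi fun t ht => ?_
    have h := (Complex.hasSum_ofReal.2 (hasSum_cauchyC_succ_mul ht)).mul_left
      ((t : ℂ) ^ (s - 1))
    simp only [smul_eq_mul, ← mul_sub, ← Complex.ofReal_sub]
    rw [← h.tsum_eq]
    congr 1
    funext n
    push_cast
    ring

lemma riemannZeta_eq_of_one_lt_re {s : ℂ} (hs : 1 < s.re) :
    riemannZeta s = 1 / (s - 1) + 1 - ∑' n : ℕ, (cauchyC (n + 1) : ℂ) * altSum n 2 s := by
  have h1 : s - 1 ≠ 0 := fun h => by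
    rw [sub_eq_zero.1 h] at hs
    simp at hs
  have hG : Complex.Gamma s = (s - 1) * Complex.Gamma (s - 1) := by
    simpa using Complex.Gamma_add_one (s - 1) h1
  have hG0 : Complex.Gamma (s - 1) ≠ 0 :=
    Complex.Gamma_ne_zero_of_re_pos (by simpa using hs)
  have h := (hasSum_Gamma_mul_cauchyC_mul_altSum hs).tsum_eq
  rw [tsum_mul_left, hG] at h
  have h' : (s - 1) * (∑' n : ℕ, (cauchyC (n + 1) : ℂ) * altSum n 2 s) =
      1 - (s - 1) * (riemannZeta s - 1) :=
    mul_left_cancel₀ hG0 (by linear_combination h)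
  field_simp
  linear_combination h'

lemma riemannZeta_eq_sub_tsum {s : ℂ} (hs : s ≠ 1) :
    riemannZeta s = 1 / (s - 1) + 1 - ∑' n : ℕ, (cauchyC (n + 1) : ℂ) * altSum n 2 s := by
  have hopen : IsOpen ({1}ᶜ : Set ℂ) := isOpen_compl_singleton
  have hζ : AnalyticOnNhd ℂ riemannZeta {1}ᶜ :=
    DifferentiableOn.analyticOnNhd
      (fun z hz => (differentiableAt_riemannZeta hz).differentiableWithinAt) hopen
  have hR : AnalyticOnNhd ℂ (fun s : ℂ => 1 / (s - 1) + 1 -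
      ∑' n : ℕ, (cauchyC (n + 1) : ℂ) * altSum n 2 s) {1}ᶜ := by
    refine DifferentiableOn.analyticOnNhd (fun z hz => DifferentiableAt.differentiableWithinAt ?_)
      hopen
    have hz' : z - 1 ≠ 0 := sub_ne_zero.2 hz
    exact ((by fun_prop (disch := exact hz') :
      DifferentiableAt ℂ (fun s : ℂ => 1 / (s - 1) + 1) z)).sub
      (differentiable_tsum_cauchyC_mul_altSum z)
  have hconn : IsPreconnected ({1}ᶜ : Set ℂ) :=
    (isConnected_compl_singleton_of_one_lt_rank (by simp [Complex.rank_real_complex]) 1).2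
  refine hζ.eqOn_of_preconnected_of_eventuallyEq hR hconn (z₀ := 2) (by simp) ?_ hs
  filter_upwards [(isOpen_lt continuous_const Complex.continuous_re).mem_nhds
    (show (1 : ℝ) < (2 : ℂ).re by simp)] with z hz
  exact riemannZeta_eq_of_one_lt_re hz

/-- Series for the zeta function with the normalized Cauchy numbers of the second kind:
for every `s ≠ 1`, the series `Σ_{n=0}^∞ C_{n+1} Σ_{k=0}^n (−1)^k C(n,k) (k+2)^{−s}`
converges and `ζ(s) = 1/(s−1) + 1 − Σ_{n=0}^∞ C_{n+1} Σ_{k=0}^n (−1)^k C(n,k) (k+2)^{−s}`. -/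
theorem zeta_cauchy_second_kind_series (s : ℂ) (hs : s ≠ 1) :
    ∃ L : ℂ,
      Tendsto (fun N : ℕ => ∑ n ∈ Finset.range N, (Complex.ofReal (cauchyC (n + 1))) *
          ∑ k ∈ Finset.range (n + 1), (-1) ^ k * (n.choose k : ℂ) * ((k : ℂ) + 2) ^ (-s))
        atTop (nhds L) ∧
      riemannZeta s = 1 / (s - 1) + 1 - L :=
  ⟨_, by simpa [altSum] using (summable_cauchyC_mul_altSum s).hasSum.tendsto_sum_nat,
    by simpa [altSum] using riemannZeta_eq_sub_tsum hs⟩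
end

section
/- The Euler–Mascheroni constant γ satisfies γ = 1 − Σ_{n=0}^∞ C_{n+1}/((n+1)(n+2)), where C_n are the normalized Cauchy numbers of the second kind, the series being convergent. -/
open Filter Finset intervalIntegral

lemma prod_add_div_prod_add_le {x y : ℝ} (hx₀ : 0 ≤ x) (hx₁ : x ≤ 1) (hy : 2 ≤ y) (N : ℕ) :
    (∏ i ∈ Finset.range N, (x + (i : ℝ))) / ∏ i ∈ Finset.range N, (y + (i : ℝ)) ≤
      1 / ((N : ℝ) + 1) := by
  induction N with
  | zero => simp
  | succ N ih =>
    have hN : (0 : ℝ) ≤ N := N.cast_nonneg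
    rw [Finset.prod_range_succ, Finset.prod_range_succ, mul_div_mul_comm]
    have h : (x + N) / (y + N) ≤ ((N : ℝ) + 1) / (N + 2) := by
      rw [div_le_div_iff₀ (by positivity) (by positivity)]
      nlinarith
    calc _ ≤ 1 / ((N : ℝ) + 1) * (((N : ℝ) + 1) / (N + 2)) := by gcongr
      _ = _ := by
        push_cast
        field_simp
        ring

/-- The inverse factorial (Newton) expansion of `1 / (y - x)` with its remainder. -/
lemma sum_prod_add_div_prod_add {x y : ℝ} (hx : x < y) (hy : 0 < y) (N : ℕ) :
    ∑ n ∈ Finset.range N, (∏ i ∈ Finset.range n, (x + (i : ℝ))) /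
        ∏ i ∈ Finset.range (n + 1), (y + (i : ℝ)) =
      1 / (y - x) - (∏ i ∈ Finset.range N, (x + (i : ℝ))) /
        (∏ i ∈ Finset.range N, (y + (i : ℝ))) / (y - x) := by
  have hyx : y - x ≠ 0 := by linarith
  induction N with
  | zero => simp
  | succ N ih =>
    have hP : ∏ i ∈ Finset.range N, (y + (i : ℝ)) ≠ 0 :=
      Finset.prod_ne_zero_iff.2 fun i _ => by positivity
    have hN : y + (N : ℝ) ≠ 0 := by positivity
    rw [Finset.sum_range_succ, ih, Finset.prod_range_succ, Finset.prod_range_succ]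
    field_simp
    ring

lemma cauchyC_mul_factorial (n : ℕ) :
    cauchyC n * (n.factorial : ℝ) = ∫ x in (0:ℝ)..1, ∏ i ∈ Finset.range n, (x + (i : ℝ)) := by
  rw [cauchyC, intervalIntegral.integral_div, div_mul_cancel₀ _ (by positivity)]

lemma integral_one_div_sub {y : ℝ} (hy : 1 < y) :
    ∫ x in (0:ℝ)..1, 1 / (y - x) = Real.log y - Real.log (y - 1) := by
  rw [intervalIntegral.integral_comp_sub_left (fun x => 1 / x) y, sub_zero,
    integral_one_div_of_pos (by linarith) (by linarith), Real.log_div (by linarith) (by linarith)]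

/-- Integrating the inverse factorial expansion of `1 / (y - x)` over `x ∈ [0, 1]`. -/
lemma hasSum_cauchyC_mul_factorial_div_prod {y : ℝ} (hy : 2 ≤ y) :
    HasSum (fun n : ℕ => cauchyC n * (n.factorial : ℝ) /
      ∏ i ∈ Finset.range (n + 1), (y + (i : ℝ))) (Real.log y - Real.log (y - 1)) := by
  rw [hasSum_iff_tendsto_nat_of_nonneg fun n => div_nonneg
    (mul_nonneg (cauchyC_nonneg n) (by positivity)) (Finset.prod_nonneg fun i _ => by positivity)]
  rw [tendsto_iff_norm_sub_tendsto_zero]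
  refine squeeze_zero (fun _ => norm_nonneg _) (fun N => ?_)
    (tendsto_one_div_add_atTop_nhds_zero_nat (𝕜 := ℝ))
  have hint : ∀ n : ℕ, IntervalIntegrable (fun x : ℝ => (∏ i ∈ Finset.range n, (x + (i : ℝ))) /
      ∏ i ∈ Finset.range (n + 1), (y + (i : ℝ))) MeasureTheory.volume 0 1 := fun n =>
    Continuous.intervalIntegrable (by fun_prop) _ _
  have hint' : IntervalIntegrable (fun x : ℝ => 1 / (y - x)) MeasureTheory.volume 0 1 := by
    refine ContinuousOn.intervalIntegrable (ContinuousOn.div₀ (by fun_prop) (by fun_prop) ?_)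
    intro x hx
    rw [Set.uIcc_of_le zero_le_one] at hx
    linarith [hx.2]
  have hsum : ∑ n ∈ Finset.range N, cauchyC n * (n.factorial : ℝ) /
      ∏ i ∈ Finset.range (n + 1), (y + (i : ℝ)) =
      ∫ x in (0:ℝ)..1, ∑ n ∈ Finset.range N, (∏ i ∈ Finset.range n, (x + (i : ℝ))) /
        ∏ i ∈ Finset.range (n + 1), (y + (i : ℝ)) := by
    rw [intervalIntegral.integral_finsetSum fun n _ => hint n]
    simp_rw [intervalIntegral.integral_div, cauchyC_mul_factorial]
  rw [hsum, ← integral_one_div_sub (by linarith), ← intervalIntegral.integral_sub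
    (Continuous.intervalIntegrable (by fun_prop) _ _) hint']
  refine (intervalIntegral.norm_integral_le_of_norm_le_const fun x hx => ?_).trans_eq
    (by rw [sub_zero, abs_one, mul_one])
  rw [Set.uIoc_of_le zero_le_one] at hx
  have hx₀ := hx.1.le
  have hyx : 1 ≤ y - x := by linarith [hx.2]
  rw [sum_prod_add_div_prod_add (by linarith) (by linarith), sub_sub_cancel_left, norm_neg,
    Real.norm_of_nonneg (by positivity)]
  exact (div_le_self (by positivity) hyx).trans (prod_add_div_prod_add_le hx₀ hx.2 hy N)

lemma hasSum_one_div_prod_add (n : ℕ) :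
    HasSum (fun k : ℕ => 1 / ∏ i ∈ Finset.range (n + 2), ((k : ℝ) + 2 + (i : ℝ)))
      (1 / (((n : ℝ) + 1) * ((n + 2).factorial : ℝ))) := by
  set D : ℕ → ℝ := fun k => 1 / ∏ i ∈ Finset.range (n + 1), ((k : ℝ) + 2 + (i : ℝ)) with hD
  have hstep : ∀ k : ℕ, 1 / ∏ i ∈ Finset.range (n + 2), ((k : ℝ) + 2 + (i : ℝ)) =
      (D k - D (k + 1)) / ((n : ℝ) + 1) := by
    intro k
    set P := ∏ i ∈ Finset.range n, ((k : ℝ) + 2 + ((i + 1 : ℕ) : ℝ)) with hPdef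
    have hP : P ≠ 0 := Finset.prod_ne_zero_iff.2 fun i _ => by positivity
    have hshift : ∏ i ∈ Finset.range (n + 1), (((k + 1 : ℕ) : ℝ) + 2 + (i : ℝ)) =
        P * ((k : ℝ) + 2 + ((n : ℝ) + 1)) := by
      rw [hPdef, Finset.prod_range_succ]
      push_cast
      congr 1
      · exact Finset.prod_congr rfl fun i _ => by ring
      · ring
    have hfirst : ∏ i ∈ Finset.range (n + 1), ((k : ℝ) + 2 + (i : ℝ)) = P * ((k : ℝ) + 2) := by
      rw [Finset.prod_range_succ', Nat.cast_zero, add_zero]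
    simp only [hD]
    rw [hshift, Finset.prod_range_succ _ (n + 1), hfirst]
    push_cast
    have h₁ : (k : ℝ) + 2 ≠ 0 := by positivity
    have h₂ : (k : ℝ) + 2 + (n + 1) ≠ 0 := by positivity
    field_simp
    ring
  have hD₀ : D 0 = 1 / ((n + 2).factorial : ℝ) := by
    simp only [hD]
    congr 1
    rw [← Finset.prod_range_add_one_eq_factorial, Finset.prod_range_succ' _ (n + 1)]
    push_cast
    simp only [zero_add, mul_one]
    exact Finset.prod_congr rfl fun i _ => by ring
  have hD_lim : Tendsto D atTop (nhds 0) := by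
    refine squeeze_zero (fun k => by positivity) (fun k => ?_)
      (tendsto_one_div_add_atTop_nhds_zero_nat (𝕜 := ℝ))
    refine one_div_le_one_div_of_le (by positivity) ?_
    rw [Finset.prod_range_succ', Nat.cast_zero, add_zero]
    have h : 1 ≤ ∏ i ∈ Finset.range n, ((k : ℝ) + 2 + ((i + 1 : ℕ) : ℝ)) := by
      refine Finset.one_le_prod fun i _ => ?_
      have : (0 : ℝ) ≤ k + ((i + 1 : ℕ) : ℝ) := by positivity
      linarith
    nlinarith [(k.cast_nonneg : (0 : ℝ) ≤ k)]
  rw [hasSum_iff_tendsto_nat_of_nonneg fun k => by positivity]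
  simp_rw [hstep, ← Finset.sum_div, Finset.sum_range_sub']
  have := (hD_lim.const_sub (D 0)).div_const ((n : ℝ) + 1)
  convert this using 2
  rw [sub_zero, hD₀, div_div, mul_comm]

lemma hasSum_cauchyC_mul_factorial_div_prod_add (n : ℕ) :
    HasSum (fun k : ℕ => cauchyC (n + 1) * ((n + 1).factorial : ℝ) /
        ∏ i ∈ Finset.range (n + 2), ((k : ℝ) + 2 + (i : ℝ)))
      (cauchyC (n + 1) / (((n : ℝ) + 1) * ((n : ℝ) + 2))) := by
  have h := (hasSum_one_div_prod_add n).mul_left (cauchyC (n + 1) * ((n + 1).factorial : ℝ))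
  simp only [mul_one_div] at h
  have hval : cauchyC (n + 1) * ((n + 1).factorial : ℝ) /
      (((n : ℝ) + 1) * ((n + 2).factorial : ℝ)) =
      cauchyC (n + 1) / (((n : ℝ) + 1) * ((n : ℝ) + 2)) := by
    rw [Nat.factorial_succ (n + 1)]
    push_cast
    field_simp
    ring
  rwa [hval] at h

lemma hasSum_log_sub_log_sub_one_div :
    HasSum (fun k : ℕ => Real.log ((k : ℝ) + 2) - Real.log ((k : ℝ) + 1) - 1 / ((k : ℝ) + 2))
      (1 - Real.eulerMascheroniConstant) := by
  convert ZetaAsymptotics.term_tsum_one using 2 with k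
  rw [ZetaAsymptotics.term_one k.succ_pos]
  push_cast
  ring_nf

theorem hasSum_cauchyC_div :
    HasSum (fun n : ℕ => cauchyC (n + 1) / (((n : ℝ) + 1) * ((n : ℝ) + 2)))
      (1 - Real.eulerMascheroniConstant) := by
  set f : ℕ × ℕ → ℝ := fun p => cauchyC (p.2 + 1) * ((p.2 + 1).factorial : ℝ) /
    ∏ i ∈ Finset.range (p.2 + 2), ((p.1 : ℝ) + 2 + (i : ℝ)) with hf
  have hf₀ : 0 ≤ f := fun p => div_nonneg
    (mul_nonneg (cauchyC_nonneg _) (by positivity)) (by positivity)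
  have hrow : ∀ k : ℕ, HasSum (fun n => f (k, n))
      (Real.log ((k : ℝ) + 2) - Real.log ((k : ℝ) + 1) - 1 / ((k : ℝ) + 2)) := by
    intro k
    have h := hasSum_cauchyC_mul_factorial_div_prod
      (y := (k : ℝ) + 2) (by linarith [(k.cast_nonneg : (0 : ℝ) ≤ k)])
    rw [← hasSum_nat_add_iff' 1] at h
    simpa [hf, cauchyC, show (k : ℝ) + 2 - 1 = k + 1 by ring] using h
  have hsummable : Summable f := by
    rw [summable_prod_of_nonneg hf₀]
    refine ⟨fun k => (hrow k).summable, ?_⟩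
    simp_rw [fun k => (hrow k).tsum_eq]
    exact hasSum_log_sub_log_sub_one_div.summable
  have hsum : HasSum f (1 - Real.eulerMascheroniConstant) := by
    rw [hasSum_log_sub_log_sub_one_div.unique (hsummable.hasSum.prod_fiberwise hrow)]
    exact hsummable.hasSum
  exact ((Equiv.prodComm ℕ ℕ).hasSum_iff.2 hsum).prod_fiberwise
    hasSum_cauchyC_mul_factorial_div_prod_add

/-- The Euler–Mascheroni constant satisfies `γ = 1 − Σ_{n=0}^∞ C_{n+1}/((n+1)(n+2))`,
where `C_n` are the normalized Cauchy numbers of the second kind,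
the series being convergent. -/
theorem eulerMascheroni_cauchy_series :
    ∃ L : ℝ,
      Tendsto (fun N : ℕ => ∑ n ∈ Finset.range N,
          cauchyC (n + 1) / (((n : ℝ) + 1) * ((n : ℝ) + 2))) atTop (nhds L) ∧
      Real.eulerMascheroniConstant = 1 - L :=
  ⟨1 - Real.eulerMascheroniConstant, hasSum_cauchyC_div.tendsto_sum_nat, by ring⟩
end

section
/- Let s and v be complex numbers with Re s > 1 and Re v > 0. Then the series Σ_{n=0}^∞ |G_{n+1}| Σ_{k=0}^n (−1)^k C(n,k) (k+v)^{−s} converges and Σ_{n=0}^∞ (n+v)^{−s} = v^{1−s}/(s−1) + Σ_{n=0}^∞ |G_{n+1}| Σ_{k=0}^n (−1)^k C(n,k) (k+v)^{−s}. -/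
open Filter Finset intervalIntegral

/-- Gregory's coefficients `G_n = ∫₀¹ x(x−1)⋯(x−n+1)/n! dx`. -/
noncomputable def gregoryG (n : ℕ) : ℝ :=
  ∫ x in (0:ℝ)..1, (∏ i ∈ Finset.range n, (x - (i : ℝ))) / (n.factorial : ℝ)

theorem ringChoose_eq_prod_range_div (x : ℝ) (n : ℕ) :
    Ring.choose x n = (∏ i ∈ Finset.range n, (x - (i : ℝ))) / (n.factorial : ℝ) := by
  rw [Ring.choose_eq_smul, ← descPochhammer_eval_eq_prod_range,
    ← descPochhammer_map (Int.castRingHom ℝ), Polynomial.eval_map, ← algebraMap_int_eq,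
    ← Polynomial.aeval_def, Polynomial.aeval_eq_smeval, smul_eq_mul, inv_mul_eq_div]

theorem hasSum_prod_range_sub_mul_neg_pow (x : ℝ) {z : ℝ} (hz : 0 < z) (hz1 : z < 1) :
    HasSum (fun n : ℕ => (∏ i ∈ Finset.range n, (x - (i : ℝ))) / (n.factorial : ℝ) * (-z) ^ n)
      ((1 - z) ^ x) := by
  have h := (Real.one_add_rpow_hasFPowerSeriesOnBall_zero (a := x)).hasSum (y := -z) (by
    simp [abs_of_pos hz, hz1, ← ofReal_norm])
  simp only [binomialSeries_apply, List.ofFn_const, List.prod_replicate, smul_eq_mul,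
    ringChoose_eq_prod_range_div, ← sub_eq_add_neg] at h
  simpa only [zero_sub, ← sub_eq_add_neg] using h

theorem neg_one_pow_mul_prod_range_succ_sub_bounds {x : ℝ} (hx : 0 ≤ x) (hx1 : x ≤ 1) (n : ℕ) :
    0 ≤ (-1) ^ n * ∏ i ∈ Finset.range (n + 1), (x - (i : ℝ)) ∧
      (-1) ^ n * ∏ i ∈ Finset.range (n + 1), (x - (i : ℝ)) ≤ (n + 1).factorial := by
  induction n with
  | zero => simpa using ⟨hx, hx1⟩
  | succ n ih =>
    have h : (-1) ^ (n + 1) * ∏ i ∈ Finset.range (n + 1 + 1), (x - (i : ℝ)) =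
        ((n + 1 : ℕ) - x) * ((-1) ^ n * ∏ i ∈ Finset.range (n + 1), (x - (i : ℝ))) := by
      rw [prod_range_succ _ (n + 1)]
      ring
    rw [h, Nat.factorial_succ (n + 1), Nat.cast_mul]
    have hn : (0 : ℝ) ≤ n := n.cast_nonneg
    push_cast
    refine ⟨mul_nonneg (by linarith) ih.1, mul_le_mul (by linarith) ih.2 ih.1 (by linarith)⟩

theorem abs_prod_range_sub_div_factorial_le_one {x : ℝ} (hx : 0 ≤ x) (hx1 : x ≤ 1) (n : ℕ) :
    |(∏ i ∈ Finset.range n, (x - (i : ℝ))) / (n.factorial : ℝ)| ≤ 1 := by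
  cases n with
  | zero => simp
  | succ n =>
    have h := neg_one_pow_mul_prod_range_succ_sub_bounds hx hx1 n
    have habs : |∏ i ∈ Finset.range (n + 1), (x - (i : ℝ))| =
        (-1) ^ n * ∏ i ∈ Finset.range (n + 1), (x - (i : ℝ)) := by
      rw [← abs_of_nonneg h.1, abs_mul]
      simp
    rw [abs_div, habs, Nat.abs_cast]
    exact div_le_one_of_le₀ h.2 (Nat.cast_nonneg _)

theorem abs_gregoryG_succ (n : ℕ) : |gregoryG (n + 1)| = (-1) ^ n * gregoryG (n + 1) := by
  have h : 0 ≤ (-1) ^ n * gregoryG (n + 1) := by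
    rw [gregoryG, ← intervalIntegral.integral_const_mul]
    refine intervalIntegral.integral_nonneg zero_le_one fun x hx => ?_
    rw [← mul_div_assoc]
    exact div_nonneg (neg_one_pow_mul_prod_range_succ_sub_bounds hx.1 hx.2 n).1 (Nat.cast_nonneg _)
  rw [← abs_of_nonneg h, abs_mul]
  simp

theorem hasSum_gregoryG_mul_neg_pow {t : ℝ} (ht : 0 < t) :
    HasSum (fun n : ℕ => gregoryG n * (-(1 - Real.exp (-t))) ^ n) ((1 - Real.exp (-t)) / t) := by
  set z := 1 - Real.exp (-t) with hz
  have hz0 : 0 < z := by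
    have := Real.exp_lt_one_iff.2 (neg_lt_zero.2 ht)
    linarith
  have hz1 : z < 1 := by linarith [Real.exp_pos (-t)]
  have h : HasSum (fun n : ℕ => ∫ x in (0:ℝ)..1,
      (∏ i ∈ Finset.range n, (x - (i : ℝ))) / (n.factorial : ℝ) * (-z) ^ n)
      (∫ x in (0:ℝ)..1, (1 - z) ^ x) := by
    refine intervalIntegral.hasSum_integral_of_dominated_convergence (fun n _ => z ^ n)
      (fun n => Continuous.aestronglyMeasurable (by fun_prop)) (fun n => ?_) ?_ ?_ ?_
    · refine Eventually.of_forall fun x hx => ?_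
      rw [Set.uIoc_of_le zero_le_one] at hx
      rw [norm_mul, norm_pow, norm_neg, Real.norm_of_nonneg hz0.le]
      exact mul_le_of_le_one_left (by positivity)
        (abs_prod_range_sub_div_factorial_le_one hx.1.le hx.2 n)
    · exact Eventually.of_forall fun x _ => summable_geometric_of_lt_one hz0.le hz1
    · exact intervalIntegrable_const
    · exact Eventually.of_forall fun x _ => hasSum_prod_range_sub_mul_neg_pow x hz0 hz1
  have hint : ∫ x in (0:ℝ)..1, (1 - z) ^ x = z / t := by
    have hexp (x : ℝ) : (1 - z) ^ x = Real.exp (-t * x) := by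
      rw [hz, sub_sub_cancel, ← Real.exp_mul]
    simp_rw [hexp]
    rw [intervalIntegral.integral_comp_mul_left (fun x => Real.exp x) (neg_ne_zero.2 ht.ne'),
      integral_exp, smul_eq_mul, hz]
    simp only [mul_one, mul_zero, Real.exp_zero]
    field_simp
    ring
  rw [hint] at h
  simpa only [intervalIntegral.integral_mul_const, gregoryG] using h

theorem hasSum_abs_gregoryG_mul_pow {t : ℝ} (ht : 0 < t) :
    HasSum (fun n : ℕ => |gregoryG (n + 1)| * (1 - Real.exp (-t)) ^ n)
      (1 / (1 - Real.exp (-t)) - 1 / t) := by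
  have hz : 1 - Real.exp (-t) ≠ 0 := by
    have := Real.exp_lt_one_iff.2 (neg_lt_zero.2 ht)
    linarith
  have h := ((hasSum_nat_add_iff' 1).2 (hasSum_gregoryG_mul_neg_pow ht)).mul_left
    (-(1 - Real.exp (-t))⁻¹)
  convert! h using 1
  · funext n
    rw [abs_gregoryG_succ, pow_succ, neg_pow (1 - Real.exp (-t))]
    field_simp
  · simp only [sum_range_one, gregoryG, range_zero, prod_empty, Nat.factorial_zero, Nat.cast_one,
      div_one, integral_one, sub_zero, pow_zero, mul_one]
    field_simp
    ring

theorem one_div_one_sub_exp_neg_le {t : ℝ} (ht : 0 < t) :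
    1 / (1 - Real.exp (-t)) ≤ 1 + 1 / t := by
  have h1 : 0 < 1 - Real.exp (-t) := sub_pos.2 (Real.exp_lt_one_iff.2 (neg_lt_zero.2 ht))
  have h2 : Real.exp (-t) * (t + 1) ≤ 1 := by
    rw [Real.exp_neg, inv_mul_le_iff₀ (Real.exp_pos t), mul_one]
    exact Real.add_one_le_exp t
  rw [div_le_iff₀ h1]
  field_simp
  linarith

theorem norm_cpow_mul_exp_neg_mul (a r : ℂ) {t : ℝ} (ht : 0 < t) :
    ‖(t : ℂ) ^ (a - 1) * Complex.exp (-(r * t))‖ = t ^ (a.re - 1) * Real.exp (-(r.re * t)) := by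
  rw [norm_mul, Complex.norm_cpow_eq_rpow_re_of_pos ht, Complex.norm_exp]
  simp

theorem measurable_cpow_mul_exp_neg_mul (a r : ℂ) :
    Measurable fun t : ℝ => (t : ℂ) ^ (a - 1) * Complex.exp (-(r * t)) := by
  fun_prop

open MeasureTheory Set in
theorem integrableOn_rpow_mul_exp_neg_mul_Ioi {a r : ℝ} (ha : 0 < a) (hr : 0 < r) :
    IntegrableOn (fun t : ℝ => t ^ (a - 1) * Real.exp (-(r * t))) (Ioi 0) := by
  simpa using integrableOn_rpow_mul_exp_neg_mul_rpow (p := 1) (s := a - 1) (b := r)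
    (by linarith) one_pos hr

open MeasureTheory Set in
theorem integrableOn_cpow_mul_exp_neg_mul_Ioi {a r : ℂ} (ha : 0 < a.re) (hr : 0 < r.re) :
    IntegrableOn (fun t : ℝ => (t : ℂ) ^ (a - 1) * Complex.exp (-(r * t))) (Ioi 0) := by
  refine (integrableOn_rpow_mul_exp_neg_mul_Ioi ha hr).mono'
    (measurable_cpow_mul_exp_neg_mul a r).aestronglyMeasurable ?_
  filter_upwards [ae_restrict_mem measurableSet_Ioi] with t ht
  exact (norm_cpow_mul_exp_neg_mul a r ht).le

open MeasureTheory Set in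
theorem differentiableAt_integral_cpow_mul_exp_neg_mul {a r : ℂ} (ha : 0 < a.re) (hr : 0 < r.re) :
    DifferentiableAt ℂ
      (fun w : ℂ => ∫ t : ℝ in Ioi 0, (t : ℂ) ^ (a - 1) * Complex.exp (-(w * t))) r := by
  have hU : {w : ℂ | r.re / 2 < w.re} ∈ nhds r :=
    (isOpen_lt continuous_const Complex.continuous_re).mem_nhds (by simp; linarith)
  refine (hasDerivAt_integral_of_dominated_loc_of_deriv_le
    (F' := fun w t => (t : ℂ) ^ (a - 1) * (Complex.exp (-(w * t)) * (-t)))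
    (bound := fun t => t ^ ((a.re + 1) - 1) * Real.exp (-(r.re / 2 * t))) hU
    (Eventually.of_forall fun w => (measurable_cpow_mul_exp_neg_mul a w).aestronglyMeasurable)
    (integrableOn_cpow_mul_exp_neg_mul_Ioi ha hr) ?_ ?_
    (integrableOn_rpow_mul_exp_neg_mul_Ioi (by linarith) (by linarith)) ?_).2.differentiableAt
  · exact Measurable.aestronglyMeasurable (by fun_prop)
  · filter_upwards [ae_restrict_mem measurableSet_Ioi] with t ht w hw
    have ht : 0 < t := ht
    rw [← mul_assoc, norm_mul, norm_cpow_mul_exp_neg_mul a w ht, norm_neg, Complex.norm_real,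
      Real.norm_of_nonneg ht.le, mul_right_comm, add_sub_right_comm, Real.rpow_add_one ht.ne']
    have hw : r.re / 2 < w.re := hw
    gcongr
  · refine Eventually.of_forall fun t w _ => HasDerivAt.const_mul _ ?_
    have h : HasDerivAt (fun w : ℂ => -(w * t)) (-(t : ℂ)) w := by
      simpa using (hasDerivAt_mul_const (x := w) (t : ℂ)).fun_neg
    exact h.cexp

open MeasureTheory Set in
theorem integral_cpow_mul_exp_neg_mul_Ioi_complex {a r : ℂ} (ha : 0 < a.re) (hr : 0 < r.re) :
    ∫ t : ℝ in Ioi 0, (t : ℂ) ^ (a - 1) * Complex.exp (-(r * t)) =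
      r ^ (-a) * Complex.Gamma a := by
  have hopen : IsOpen {w : ℂ | 0 < w.re} := isOpen_lt continuous_const Complex.continuous_re
  have hF : AnalyticOnNhd ℂ
      (fun w : ℂ => ∫ t : ℝ in Ioi 0, (t : ℂ) ^ (a - 1) * Complex.exp (-(w * t)))
      {w : ℂ | 0 < w.re} :=
    DifferentiableOn.analyticOnNhd (fun w hw =>
      (differentiableAt_integral_cpow_mul_exp_neg_mul ha hw).differentiableWithinAt) hopen
  have hG : AnalyticOnNhd ℂ (fun w : ℂ => w ^ (-a) * Complex.Gamma a) {w : ℂ | 0 < w.re} := by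
    refine DifferentiableOn.analyticOnNhd (fun w hw => ?_) hopen
    exact ((differentiableAt_id.cpow_const (Or.inl hw)).mul_const _).differentiableWithinAt
  refine hF.eqOn_of_preconnected_of_frequently_eq hG
    (convex_halfSpace_re_gt 0).isPreconnected (z₀ := 1) (by simp) ?_ hr
  have htend : Tendsto (fun x : ℝ => (x : ℂ)) (nhdsWithin 1 {1}ᶜ) (nhdsWithin 1 {1}ᶜ) := by
    refine tendsto_nhdsWithin_iff.2 ⟨?_, ?_⟩
    · exact (Complex.continuous_ofReal.tendsto' 1 1 (by simp)).mono_left nhdsWithin_le_nhds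
    · filter_upwards [self_mem_nhdsWithin] with x hx
      simpa using hx
  refine htend.frequently (Eventually.frequently ?_)
  filter_upwards [nhdsWithin_le_nhds (lt_mem_nhds one_pos)] with x hx
  rw [Complex.integral_cpow_mul_exp_neg_mul_Ioi ha hx, one_div, Complex.inv_cpow, Complex.cpow_neg]
  rw [Complex.arg_ofReal_of_nonneg hx.le]
  exact Real.pi_pos.ne

open MeasureTheory Set in
/-- Termwise integration of a series of nonnegative functions against `t ^ (s - 1) * exp (-v t)`. -/
theorem hasSum_integral_cpow_mul_exp_neg_mul {s v : ℂ} (hs : 1 < s.re) (hv : 0 < v.re)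
    {a : ℕ → ℝ → ℝ} {A : ℝ → ℝ} (ha : ∀ n, Measurable (a n)) (hA : Measurable A)
    (hnonneg : ∀ n t, 0 < t → 0 ≤ a n t) (hsum : ∀ t, 0 < t → HasSum (fun n => a n t) (A t))
    (hle : ∀ t, 0 < t → A t ≤ 1 + 1 / t) :
    IntegrableOn (fun t : ℝ => (t : ℂ) ^ (s - 1) * Complex.exp (-(v * t)) * A t) (Ioi 0) ∧
    HasSum (fun n => ∫ t : ℝ in Ioi 0, (t : ℂ) ^ (s - 1) * Complex.exp (-(v * t)) * a n t)
      (∫ t : ℝ in Ioi 0, (t : ℂ) ^ (s - 1) * Complex.exp (-(v * t)) * A t) := by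
  have hg := measurable_cpow_mul_exp_neg_mul s v
  have hAnonneg (t : ℝ) (ht : 0 < t) : 0 ≤ A t := (hsum t ht).nonneg fun n => hnonneg n t ht
  have hmeas : Measurable fun t : ℝ => (t : ℂ) ^ (s - 1) * Complex.exp (-(v * t)) * A t :=
    hg.mul (Complex.measurable_ofReal.comp hA)
  have hint : IntegrableOn
      (fun t : ℝ => (t : ℂ) ^ (s - 1) * Complex.exp (-(v * t)) * A t) (Ioi 0) := by
    refine ((integrableOn_rpow_mul_exp_neg_mul_Ioi (a := s.re) (by linarith) hv).add
      (integrableOn_rpow_mul_exp_neg_mul_Ioi (a := s.re - 1) (by linarith) hv)).mono'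
      hmeas.aestronglyMeasurable ?_
    filter_upwards [ae_restrict_mem measurableSet_Ioi] with t ht
    have ht : 0 < t := ht
    rw [norm_mul, norm_cpow_mul_exp_neg_mul s v ht, Complex.norm_real,
      Real.norm_of_nonneg (hAnonneg t ht)]
    refine (mul_le_mul_of_nonneg_left (hle t ht) (by positivity)).trans_eq ?_
    rw [Pi.add_apply, Real.rpow_sub_one ht.ne' (s.re - 1)]
    ring
  refine ⟨hint, hasSum_integral_of_dominated_convergence
    (fun n t => ‖(t : ℂ) ^ (s - 1) * Complex.exp (-(v * t))‖ * a n t) (fun n => ?_) (fun n => ?_)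
    ?_ ?_ ?_⟩
  · exact (hg.mul (Complex.measurable_ofReal.comp (ha n))).aestronglyMeasurable
  · filter_upwards [ae_restrict_mem measurableSet_Ioi] with t ht
    rw [norm_mul, Complex.norm_real, Real.norm_of_nonneg (hnonneg n t ht)]
  · filter_upwards [ae_restrict_mem measurableSet_Ioi] with t ht
    exact (hsum t ht).summable.mul_left _
  · refine hint.norm.congr ?_
    filter_upwards [ae_restrict_mem measurableSet_Ioi] with t ht
    rw [((hsum t ht).mul_left _).tsum_eq, norm_mul _ (A t : ℂ), Complex.norm_real,
      Real.norm_of_nonneg (hAnonneg t ht)]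
  · filter_upwards [ae_restrict_mem measurableSet_Ioi] with t ht
    exact (Complex.hasSum_ofReal.2 (hsum t ht)).mul_left _

open MeasureTheory Set in
theorem integral_cpow_mul_exp_neg_mul_mul_exp_neg {s v : ℂ} (hs : 0 < s.re) (hv : 0 < v.re)
    (n : ℕ) :
    ∫ t : ℝ in Ioi 0, (t : ℂ) ^ (s - 1) * Complex.exp (-(v * t)) * (Real.exp (-t) ^ n : ℝ) =
      ((n : ℂ) + v) ^ (-s) * Complex.Gamma s := by
  have hnv : 0 < ((n : ℂ) + v).re := by
    simp only [Complex.add_re, Complex.natCast_re]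
    positivity
  rw [← integral_cpow_mul_exp_neg_mul_Ioi_complex hs hnv]
  congr 1 with t
  push_cast
  rw [mul_assoc, ← Complex.exp_nat_mul, ← Complex.exp_add]
  ring_nf

open MeasureTheory Set in
theorem integral_cpow_mul_exp_neg_mul_mul_one_sub_exp_neg_pow {s v : ℂ} (hs : 0 < s.re)
    (hv : 0 < v.re) (n : ℕ) :
    ∫ t : ℝ in Ioi 0,
      (t : ℂ) ^ (s - 1) * Complex.exp (-(v * t)) * ((1 - Real.exp (-t)) ^ n : ℝ) =
      (∑ k ∈ Finset.range (n + 1), (-1) ^ k * (n.choose k : ℂ) * ((k : ℂ) + v) ^ (-s)) *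
        Complex.Gamma s := by
  have hexpand (t : ℝ) :
      (t : ℂ) ^ (s - 1) * Complex.exp (-(v * t)) * ((1 - Real.exp (-t)) ^ n : ℝ) =
      ∑ k ∈ Finset.range (n + 1), (-1) ^ k * (n.choose k : ℂ) *
        ((t : ℂ) ^ (s - 1) * Complex.exp (-(v * t)) * (Real.exp (-t) ^ k : ℝ)) := by
    rw [sub_eq_neg_add 1, add_pow]
    push_cast
    rw [Finset.mul_sum]
    refine Finset.sum_congr rfl fun k _ => ?_
    rw [neg_pow (Complex.exp _)]
    ring
  simp_rw [hexpand]
  rw [MeasureTheory.integral_finsetSum, Finset.sum_mul]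
  · refine Finset.sum_congr rfl fun k _ => ?_
    rw [MeasureTheory.integral_const_mul, integral_cpow_mul_exp_neg_mul_mul_exp_neg hs hv, mul_assoc _ (_ ^ (-s))]
  · refine fun k _ => Integrable.const_mul ?_ _
    refine (integrableOn_cpow_mul_exp_neg_mul_Ioi hs hv).mul_bdd (c := 1)
      (Measurable.aestronglyMeasurable (by fun_prop)) ?_
    filter_upwards [ae_restrict_mem measurableSet_Ioi] with t ht
    have ht : 0 < t := ht
    rw [Complex.norm_real, norm_pow, Real.norm_of_nonneg (Real.exp_pos _).le]
    exact pow_le_one₀ (Real.exp_pos _).le (Real.exp_le_one_iff.2 (by linarith))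

theorem hasSum_exp_neg_pow {t : ℝ} (ht : 0 < t) :
    HasSum (fun n : ℕ => Real.exp (-t) ^ n) (1 / (1 - Real.exp (-t))) := by
  rw [one_div]
  exact hasSum_geometric_of_lt_one (Real.exp_pos _).le (Real.exp_lt_one_iff.2 (neg_lt_zero.2 ht))

open MeasureTheory in
/-- Series with Gregory's coefficients for the Hurwitz zeta function:
for `Re s > 1` and `Re v > 0`, the series
`Σ_{n=0}^∞ |G_{n+1}| Σ_{k=0}^n (−1)^k C(n,k) (k+v)^{−s}` converges and
`Σ_{n=0}^∞ (n+v)^{−s} = v^{1−s}/(s−1) + Σ_{n=0}^∞ |G_{n+1}| Σ_{k=0}^n (−1)^k C(n,k) (k+v)^{−s}`. -/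
theorem hurwitz_gregory_series (s v : ℂ) (hs : 1 < s.re) (hv : 0 < v.re) :
    ∃ L : ℂ,
      Tendsto (fun N : ℕ => ∑ n ∈ Finset.range N, (Complex.ofReal |gregoryG (n + 1)|) *
          ∑ k ∈ Finset.range (n + 1), (-1) ^ k * (n.choose k : ℂ) * ((k : ℂ) + v) ^ (-s))
        atTop (nhds L) ∧
      (∑' n : ℕ, ((n : ℂ) + v) ^ (-s)) = v ^ (1 - s) / (s - 1) + L := by
  have hs0 : 0 < s.re := by linarith
  have hs1 : 0 < (s - 1).re := by simpa using hs
  have hs1' : s - 1 ≠ 0 := fun h => by simp [h] at hs1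
  have hΓ : Complex.Gamma s ≠ 0 := Complex.Gamma_ne_zero_of_re_pos hs0
  have hΓ' : Complex.Gamma s = (s - 1) * Complex.Gamma (s - 1) := by
    simpa using Complex.Gamma_add_one (s - 1) hs1'
  obtain ⟨hζint, hζ⟩ := hasSum_integral_cpow_mul_exp_neg_mul hs hv
    (a := fun n t => Real.exp (-t) ^ n) (A := fun t => 1 / (1 - Real.exp (-t)))
    (fun n => by fun_prop) (by fun_prop) (fun n t _ => by positivity)
    (fun t ht => hasSum_exp_neg_pow ht) (fun t ht => one_div_one_sub_exp_neg_le ht)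
  obtain ⟨-, hG⟩ := hasSum_integral_cpow_mul_exp_neg_mul hs hv
    (a := fun n t => |gregoryG (n + 1)| * (1 - Real.exp (-t)) ^ n)
    (A := fun t => 1 / (1 - Real.exp (-t)) - 1 / t)
    (fun n => by fun_prop) (by fun_prop)
    (fun n t ht => mul_nonneg (abs_nonneg _) (pow_nonneg
      (sub_nonneg.2 (Real.exp_le_one_iff.2 (neg_nonpos.2 ht.le))) n))
    (fun t ht => hasSum_abs_gregoryG_mul_pow ht)
    (fun t ht => by
      have := one_div_one_sub_exp_neg_le ht
      have : 0 < 1 / t := by positivity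
      linarith)
  have hsplit : (∫ t : ℝ in Set.Ioi 0, (t : ℂ) ^ (s - 1) * Complex.exp (-(v * t)) *
        ((1 / (1 - Real.exp (-t)) - 1 / t : ℝ) : ℂ)) =
      (∫ t : ℝ in Set.Ioi 0, (t : ℂ) ^ (s - 1) * Complex.exp (-(v * t)) *
        ((1 / (1 - Real.exp (-t)) : ℝ) : ℂ)) - v ^ (-(s - 1)) * Complex.Gamma (s - 1) := by
    rw [← integral_cpow_mul_exp_neg_mul_Ioi_complex hs1 hv, ← integral_sub hζint
      (integrableOn_cpow_mul_exp_neg_mul_Ioi hs1 hv)]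
    refine setIntegral_congr_fun measurableSet_Ioi fun t ht => ?_
    have ht : (t : ℂ) ≠ 0 := Complex.ofReal_ne_zero.2 (ne_of_gt ht)
    simp only [Complex.cpow_sub (s - 1) 1 ht, Complex.cpow_one]
    push_cast
    ring
  have hζ' := hζ.div_const (Complex.Gamma s)
  simp only [integral_cpow_mul_exp_neg_mul_mul_exp_neg hs0 hv, mul_div_cancel_right₀ _ hΓ] at hζ'
  rw [hsplit] at hG
  have hG' := hG.div_const (Complex.Gamma s)
  simp only [Complex.ofReal_mul, mul_left_comm _ ((|gregoryG _| : ℝ) : ℂ), MeasureTheory.integral_const_mul,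
    integral_cpow_mul_exp_neg_mul_mul_one_sub_exp_neg_pow hs0 hv, mul_div_assoc,
    mul_div_cancel_right₀ _ hΓ] at hG'
  refine ⟨_, hG'.tendsto_sum_nat, ?_⟩
  rw [hζ'.tsum_eq, neg_sub, hΓ']
  have hΓ1 : Complex.Gamma (s - 1) ≠ 0 := Complex.Gamma_ne_zero_of_re_pos hs1
  field_simp
  ring
end
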